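/- Let v, w be smooth zero-mean periodic vector fields on 𝕋³. Then ‖v ⊗ w‖_{W^{−1/6,2}} ≤ C ‖v‖_{W^{1/6,2}} ‖w‖_{W^{1+1/6,2}}. -/

import Mathlib

open scoped BigOperators
open MeasureTheory

/-- squared euclidean length of a lattice vector `k ∈ ℤ³` -/
noncomputable def knsq (k : Fin 3 → ℤ) : ℝ := ∑ i, ((k i : ℝ)) ^ 2

/-- Fourier coefficient of a periodic function on `𝕋³` -/
noncomputable def fcoef (f : (Fin 3 → ℝ) → ℂ) (k : Fin 3 → ℤ) : ℂ :=
  ∫ x in Set.Icc (0 : Fin 3 → ℝ) 1,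
    f x * Complex.exp (-(2 * Real.pi * Complex.I) * (∑ i, (k i : ℝ) * x i))

/-- squared Sobolev `W^{s,2}` norm on `𝕋³` defined through Fourier coefficients -/
noncomputable def sobSq (s : ℝ) (f : (Fin 3 → ℝ) → ℂ) : ℝ :=
  ∑' k : Fin 3 → ℤ, (1 + knsq k) ^ s * ‖fcoef f k‖ ^ 2

open ComplexConjugate in
/-- Parseval's identity on the unit cube, for continuous (not necessarily periodic) functions. -/
theorem hasSum_conj_fcoef_mul_fcoef {f g : (Fin 3 → ℝ) → ℂ} (hf : Continuous f)
    (hg : Continuous g) :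
    HasSum (fun k => conj (fcoef f k) * fcoef g k)
      (∫ x in Set.Icc (0 : Fin 3 → ℝ) 1, conj (f x) * g x) := by
  let _ : MeasureSpace UnitAddCircle := ⟨AddCircle.haarAddCircle⟩
  have _ : IsProbabilityMeasure (volume : Measure UnitAddCircle) :=
    inferInstanceAs (IsProbabilityMeasure AddCircle.haarAddCircle)
  let r : UnitAddTorus (Fin 3) → (Fin 3 → ℝ) := fun y =>
    (UnitAddTorus.measurableEquivPiIoc (0 : Fin 3 → ℝ) y).1
  have hr : Measurable r :=
    measurable_subtype_coe.comp (UnitAddTorus.measurableEquivPiIoc (0 : Fin 3 → ℝ)).measurable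
  have hrx : ∀ x : Fin 3 → ℝ, (∀ i, x i ∈ Set.Ioc ((0 : Fin 3 → ℝ) i) ((0 : Fin 3 → ℝ) i + 1)) →
      r (fun i => (x i : UnitAddCircle)) = x := by
    intro x hx
    have := (UnitAddTorus.measurableEquivPiIoc (0 : Fin 3 → ℝ)).apply_symm_apply ⟨x, hx⟩
    exact congrArg Subtype.val this
  have hrI : ∀ y, r y ∈ Set.Icc (0 : Fin 3 → ℝ) 1 := by
    intro y
    have h := (UnitAddTorus.measurableEquivPiIoc (0 : Fin 3 → ℝ) y).2
    refine ⟨fun i => (h i).1.le, fun i => ?_⟩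
    have h2 : r y i ≤ (0 : Fin 3 → ℝ) i + 1 := (h i).2
    rwa [Pi.zero_apply, zero_add] at h2
  have hset : {x : Fin 3 → ℝ | ∀ i, x i ∈ Set.Ioc ((0 : Fin 3 → ℝ) i) ((0 : Fin 3 → ℝ) i + 1)}
      =ᵐ[volume] Set.Icc (0 : Fin 3 → ℝ) 1 := by
    have h := Measure.univ_pi_Ioc_ae_eq_Icc (μ := fun _ : Fin 3 => (volume : Measure ℝ))
      (f := 0) (g := 1)
    have e : {x : Fin 3 → ℝ | ∀ i, x i ∈ Set.Ioc ((0 : Fin 3 → ℝ) i) ((0 : Fin 3 → ℝ) i + 1)}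
        = Set.univ.pi fun i => Set.Ioc ((0 : Fin 3 → ℝ) i) ((1 : Fin 3 → ℝ) i) := by
      ext x
      simp [Set.mem_pi]
    rw [e]
    exact h
  have key : ∀ F : (Fin 3 → ℝ) → UnitAddTorus (Fin 3) → ℂ,
      ∫ y, F (r y) y = ∫ x in Set.Icc (0 : Fin 3 → ℝ) 1, F x (fun i => (x i : UnitAddCircle)) := by
    intro F
    rw [UnitAddTorus.integral_preimage (fun y => F (r y) y) 0, ← setIntegral_congr_set hset]
    refine setIntegral_congr_fun (MeasurableSet.univ_pi' (fun i => measurableSet_Ioc)) ?_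
    intro x hx
    simp only [hrx x hx]
  have hmem : ∀ {u : (Fin 3 → ℝ) → ℂ}, Continuous u →
      MemLp (fun y => u (r y)) 2 (volume : Measure (UnitAddTorus (Fin 3))) := by
    intro u hu
    obtain ⟨M, hM⟩ := isCompact_Icc.exists_bound_of_continuousOn
      (s := Set.Icc (0 : Fin 3 → ℝ) 1) hu.continuousOn
    exact MemLp.of_bound (hu.measurable.comp hr).aestronglyMeasurable M
      (Filter.Eventually.of_forall fun y => hM _ (hrI y))
  have hexp : ∀ (k : Fin 3 → ℤ) (x : Fin 3 → ℝ),
      UnitAddTorus.mFourier (-k) (fun i => (x i : UnitAddCircle)) =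
        Complex.exp (-(2 * Real.pi * Complex.I) * (∑ i, (k i : ℝ) * x i)) := by
    intro k x
    simp only [UnitAddTorus.mFourier, ContinuousMap.coe_mk, fourier_coe_apply, ← Complex.exp_sum]
    congr 1
    push_cast
    rw [Finset.mul_sum]
    refine Finset.sum_congr rfl fun i _ => ?_
    simp
    ring
  have hcoef : ∀ {u : (Fin 3 → ℝ) → ℂ} (hu : Continuous u) (k : Fin 3 → ℤ),
      UnitAddTorus.mFourierCoeff ((hmem hu).toLp) k = fcoef u k := by
    intro u hu k
    have h1 : UnitAddTorus.mFourierCoeff ((hmem hu).toLp) k =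
        ∫ y, UnitAddTorus.mFourier (-k) y • u (r y) := by
      refine integral_congr_ae ?_
      filter_upwards [(hmem hu).coeFn_toLp] with y hy
      rw [hy]
    rw [h1, key (fun x y => UnitAddTorus.mFourier (-k) y • u x)]
    refine setIntegral_congr_fun measurableSet_Icc fun x _ => ?_
    simp only [hexp, smul_eq_mul]
    rw [mul_comm]
  have h := UnitAddTorus.hasSum_prod_mFourierCoeff ((hmem hf).toLp) ((hmem hg).toLp)
  simp only [hcoef hf, hcoef hg] at h
  convert! h using 1
  rw [← key (fun x _ => conj (f x) * g x)]
  refine integral_congr_ae ?_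
  filter_upwards [(hmem hf).coeFn_toLp, (hmem hg).coeFn_toLp] with y hy hy'
  rw [hy, hy']

theorem continuous_exp_pairing (c : ℂ) (k : Fin 3 → ℤ) :
    Continuous fun x : Fin 3 → ℝ => Complex.exp (c * (∑ i, (k i : ℝ) * x i)) := by
  fun_prop

open ComplexConjugate in
theorem enorm_fcoef_mul_le {f g : (Fin 3 → ℝ) → ℂ} (hf : Continuous f) (hg : Continuous g)
    (k : Fin 3 → ℤ) :
    ‖fcoef (fun x => f x * g x) k‖ₑ ≤ ∑' m, ‖fcoef f (k - m)‖ₑ * ‖fcoef g m‖ₑ := by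
  let u : (Fin 3 → ℝ) → ℂ := fun x =>
    conj (f x * Complex.exp (-(2 * Real.pi * Complex.I) * (∑ i, (k i : ℝ) * x i)))
  have hu : Continuous u :=
    Complex.continuous_conj.comp (hf.mul (continuous_exp_pairing _ k))
  have hcoef : ∀ m, conj (fcoef u m) = fcoef f (k - m) := by
    intro m
    unfold fcoef
    rw [← integral_conj]
    refine integral_congr_ae (Filter.Eventually.of_forall fun x => ?_)
    simp only [u, map_mul, Complex.conj_conj, ← Complex.exp_conj, mul_assoc, ← Complex.exp_add]
    congr 2
    have hsum : ∑ i, ((k - m) i : ℝ) * x i = ∑ i, (k i : ℝ) * x i - ∑ i, (m i : ℝ) * x i := by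
      simp [sub_mul]
    simp only [hsum, map_add, map_neg, map_mul, Complex.conj_I, Complex.conj_ofReal, map_ofNat,
      Complex.ofReal_sub]
    ring
  have h := hasSum_conj_fcoef_mul_fcoef hu hg
  have hval : ∫ x in Set.Icc (0 : Fin 3 → ℝ) 1, conj (u x) * g x =
      fcoef (fun x => f x * g x) k := by
    refine integral_congr_ae (Filter.Eventually.of_forall fun x => ?_)
    simp only [u, Complex.conj_conj]
    ring
  rw [← hval, ← h.tsum_eq]
  refine enorm_tsum_le_tsum_enorm.trans_eq ?_
  simp only [hcoef, enorm_mul]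

theorem tsum_enorm_fcoef_sq_lt_top {f : (Fin 3 → ℝ) → ℂ} (hf : Continuous f) :
    ∑' k, ‖fcoef f k‖ₑ ^ 2 < ⊤ := by
  have h := (hasSum_conj_fcoef_mul_fcoef hf hf).summable.norm
  simp only [norm_mul, RCLike.norm_conj] at h
  have h' := h.tsum_ofReal_lt_top
  convert h' using 3 with k
  rw [ENNReal.ofReal_mul (norm_nonneg _), ofReal_norm, sq]

theorem setIntegral_fderiv_single_eq_zero {f : (Fin 3 → ℝ) → ℂ} (hf : ContDiff ℝ 1 f)
    (i : Fin 3) (hp : ∀ x, f (x + Pi.single i 1) = f x) :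
    ∫ x in Set.Icc (0 : Fin 3 → ℝ) 1, fderiv ℝ f x (Pi.single i 1) = 0 := by
  have hc : Continuous fun x => fderiv ℝ f x (Pi.single i 1) :=
    (hf.continuous_fderiv one_ne_zero).clm_apply continuous_const
  have hsum : ∀ x, ∑ j : Fin 3, (if j = i then fderiv ℝ f x else 0) (Pi.single j 1) =
      fderiv ℝ f x (Pi.single i 1) := by
    intro x
    rw [Finset.sum_eq_single i] <;> simp +contextual
  have h := integral_divergence_of_hasFDerivAt_off_countable' (n := 2) (E := ℂ) 0 1 zero_le_one
    (fun j x => if j = i then f x else 0) (fun j x => if j = i then fderiv ℝ f x else 0) ∅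
    Set.countable_empty
    (fun j => by split_ifs <;> [exact hf.continuous.continuousOn; exact continuousOn_const])
    (fun x _ j => by
      split_ifs
      · exact (hf.differentiable one_ne_zero x).hasFDerivAt
      · exact hasFDerivAt_const _ _)
    (by
      simp only [hsum]
      exact hc.continuousOn.integrableOn_compact isCompact_Icc)
  simp only [hsum] at h
  rw [h]
  refine Finset.sum_eq_zero fun j _ => ?_
  by_cases hj : j = i
  · subst hj
    simp only [if_true]
    rw [sub_eq_zero]
    refine integral_congr_ae (Filter.Eventually.of_forall fun y => ?_)
    simp only [Pi.one_apply, Pi.zero_apply]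
    rw [← hp (j.insertNth 0 y)]
    congr 1
    ext l
    refine Fin.succAboveCases j ?_ (fun l => ?_) l
    · simp
    · simp
  · simp [hj]

theorem fcoef_fderiv_single {f : (Fin 3 → ℝ) → ℂ} (hf : ContDiff ℝ 1 f)
    (i : Fin 3) (hp : ∀ x, f (x + Pi.single i 1) = f x) (k : Fin 3 → ℤ) :
    fcoef (fun x => fderiv ℝ f x (Pi.single i 1)) k =
      2 * Real.pi * Complex.I * k i * fcoef f k := by
  let L : (Fin 3 → ℝ) →L[ℝ] ℂ :=
    ∑ j, (-(2 * Real.pi * Complex.I) * k j) •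
      (Complex.ofRealCLM.comp (ContinuousLinearMap.proj j : (Fin 3 → ℝ) →L[ℝ] ℝ))
  have hL : ∀ x : Fin 3 → ℝ, -(2 * Real.pi * Complex.I) * (∑ i, (k i : ℝ) * x i) = L x := by
    intro x
    simp [L, Finset.mul_sum, mul_assoc]
  have hLi : L (Pi.single i 1) = -(2 * Real.pi * Complex.I) * k i := by
    rw [← hL]
    simp [Pi.single_apply]
  have hexp : ∀ x, HasFDerivAt (fun x => Complex.exp (L x)) (Complex.exp (L x) • L) x :=
    fun x => L.hasFDerivAt.cexp
  have hd : ∀ x, HasFDerivAt (fun x => f x * Complex.exp (L x))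
      (f x • (Complex.exp (L x) • L) + Complex.exp (L x) • fderiv ℝ f x) x :=
    fun x => (hf.differentiable one_ne_zero x).hasFDerivAt.mul (hexp x)
  have hperiod : ∀ x, f (x + Pi.single i 1) * Complex.exp (L (x + Pi.single i 1)) =
      f x * Complex.exp (L x) := by
    intro x
    rw [hp, map_add, hLi, Complex.exp_add]
    have : Complex.exp (-(2 * Real.pi * Complex.I) * k i) = 1 := by
      rw [Complex.exp_eq_one_iff]
      exact ⟨-k i, by push_cast; ring⟩
    rw [this, mul_one]
  have hg : ContDiff ℝ 1 fun x => f x * Complex.exp (L x) := hf.mul L.contDiff.cexp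
  have h0 := setIntegral_fderiv_single_eq_zero hg i hperiod
  have hval : ∀ x, fderiv ℝ (fun x => f x * Complex.exp (L x)) x (Pi.single i 1) =
      fderiv ℝ f x (Pi.single i 1) * Complex.exp (L x) -
        2 * Real.pi * Complex.I * k i * (f x * Complex.exp (L x)) := by
    intro x
    rw [(hd x).fderiv]
    simp only [add_apply, smul_apply, hLi, smul_eq_mul]
    ring
  have hc1 : Continuous fun x => fderiv ℝ f x (Pi.single i 1) * Complex.exp (L x) :=
    ((hf.continuous_fderiv one_ne_zero).clm_apply continuous_const).mul
      (Complex.continuous_exp.comp L.continuous)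
  have hc2 : Continuous fun x => 2 * Real.pi * Complex.I * k i * (f x * Complex.exp (L x)) :=
    continuous_const.mul hg.continuous
  simp only [hval] at h0
  rw [integral_sub (hc1.continuousOn.integrableOn_compact isCompact_Icc)
    (hc2.continuousOn.integrableOn_compact isCompact_Icc), sub_eq_zero,
    integral_const_mul] at h0
  simpa only [fcoef, hL] using h0

/-- The Fourier weight of the squared `W^{s,2}` norm, as an extended nonnegative real. -/
noncomputable def sobWeight (s : ℝ) (k : Fin 3 → ℤ) : ENNReal := ENNReal.ofReal ((1 + knsq k) ^ s)

theorem one_le_one_add_knsq (k : Fin 3 → ℤ) : 1 ≤ 1 + knsq k :=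
  le_add_of_nonneg_right (Finset.sum_nonneg fun _ _ => sq_nonneg _)

theorem one_add_knsq_pos (k : Fin 3 → ℤ) : 0 < 1 + knsq k :=
  zero_lt_one.trans_le (one_le_one_add_knsq k)

theorem one_add_knsq_add_le (m n : Fin 3 → ℤ) :
    1 + knsq (m + n) ≤ 2 * (1 + knsq m) + 2 * (1 + knsq n) := by
  have : knsq (m + n) ≤ 2 * knsq m + 2 * knsq n := by
    simp only [knsq, Finset.mul_sum, ← Finset.sum_add_distrib]
    refine Finset.sum_le_sum fun i _ => ?_
    simp only [Pi.add_apply, Int.cast_add]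
    nlinarith [sq_nonneg ((m i : ℝ) - n i)]
  linarith

theorem knsq_neg (k : Fin 3 → ℤ) : knsq (-k) = knsq k := by
  simp [knsq]

theorem sobSq_eq_toReal (s : ℝ) (f : (Fin 3 → ℝ) → ℂ) :
    sobSq s f = (∑' k, sobWeight s k * ‖fcoef f k‖ₑ ^ 2).toReal := by
  have htop : ∀ k, sobWeight s k * ‖fcoef f k‖ₑ ^ 2 ≠ ⊤ := fun k =>
    ENNReal.mul_ne_top ENNReal.ofReal_ne_top (ENNReal.pow_ne_top enorm_ne_top)
  rw [sobSq, ENNReal.tsum_toReal_eq htop]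
  refine tsum_congr fun k => ?_
  rw [sobWeight, ENNReal.toReal_mul, ENNReal.toReal_pow, toReal_enorm,
    ENNReal.toReal_ofReal (Real.rpow_nonneg (one_add_knsq_pos k).le _)]

theorem one_add_knsq_rpow_le {s : ℝ} (hs : s ≤ 2) (k : Fin 3 → ℤ) :
    (1 + knsq k) ^ s ≤ 4 * (1 + ∑ i, (k i : ℝ) ^ 4) := by
  refine (Real.rpow_le_rpow_of_exponent_le (one_le_one_add_knsq k) hs).trans ?_
  rw [Real.rpow_two]
  simp only [knsq, Fin.sum_univ_three]
  nlinarith [sq_nonneg ((k 0 : ℝ) ^ 2 - 1), sq_nonneg ((k 1 : ℝ) ^ 2 - 1),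
    sq_nonneg ((k 2 : ℝ) ^ 2 - 1), sq_nonneg ((k 0 : ℝ) ^ 2 - (k 1 : ℝ) ^ 2),
    sq_nonneg ((k 0 : ℝ) ^ 2 - (k 2 : ℝ) ^ 2), sq_nonneg ((k 1 : ℝ) ^ 2 - (k 2 : ℝ) ^ 2)]

theorem tsum_sobWeight_mul_enorm_fcoef_sq_lt_top {f : (Fin 3 → ℝ) → ℂ} (hf : ContDiff ℝ 2 f)
    (hp : ∀ x i, f (x + Pi.single i 1) = f x) {s : ℝ} (hs : s ≤ 2) :
    ∑' k, sobWeight s k * ‖fcoef f k‖ₑ ^ 2 < ⊤ := by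
  let d : Fin 3 → (Fin 3 → ℝ) → ℂ := fun i x => fderiv ℝ f x (Pi.single i 1)
  have hd : ∀ i, ContDiff ℝ 1 (d i) := fun i =>
    (hf.fderiv_right (m := 1) (by norm_num)).clm_apply contDiff_const
  have hdp : ∀ i x, d i (x + Pi.single i 1) = d i x := by
    intro i x
    have : fderiv ℝ f (x + Pi.single i 1) = fderiv ℝ f x := by
      rw [← fderiv_comp_add_right]
      congr 1
      exact funext fun y => hp y i
    simp only [d, this]
  let dd : Fin 3 → (Fin 3 → ℝ) → ℂ := fun i x => fderiv ℝ (d i) x (Pi.single i 1)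
  have hdd : ∀ i, Continuous (dd i) := fun i =>
    ((hd i).continuous_fderiv one_ne_zero).clm_apply continuous_const
  have hcoef : ∀ i k, ENNReal.ofReal ((k i : ℝ) ^ 4) * ‖fcoef f k‖ₑ ^ 2 ≤
      ‖fcoef (dd i) k‖ₑ ^ 2 := by
    intro i k
    rw [fcoef_fderiv_single (hd i) i (hdp i),
      fcoef_fderiv_single (hf.of_le one_le_two) i (fun x => hp x i)]
    rw [← ofReal_norm, ← ofReal_norm, ← ENNReal.ofReal_pow (norm_nonneg _),
      ← ENNReal.ofReal_pow (norm_nonneg _), ← ENNReal.ofReal_mul (by positivity)]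
    refine ENNReal.ofReal_le_ofReal ?_
    simp only [norm_mul, Complex.norm_ofNat, Complex.norm_real, Complex.norm_I, mul_one,
      Complex.norm_intCast, Real.norm_eq_abs, abs_of_pos Real.pi_pos]
    have h4 : (k i : ℝ) ^ 4 = |(k i : ℝ)| ^ 4 := by rw [Even.pow_abs (by decide)]
    rw [h4]
    have hpi : 1 ≤ (2 * Real.pi) ^ 4 := one_le_pow₀ (by linarith [Real.pi_gt_three])
    calc |(k i : ℝ)| ^ 4 * ‖fcoef f k‖ ^ 2
        ≤ (2 * Real.pi) ^ 4 * (|(k i : ℝ)| ^ 4 * ‖fcoef f k‖ ^ 2) :=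
          le_mul_of_one_le_left (by positivity) hpi
      _ = _ := by ring
  have hterm : ∀ k, sobWeight s k * ‖fcoef f k‖ₑ ^ 2 ≤
      4 * (‖fcoef f k‖ₑ ^ 2 + ∑ i, ‖fcoef (dd i) k‖ₑ ^ 2) := by
    intro k
    calc sobWeight s k * ‖fcoef f k‖ₑ ^ 2
        ≤ ENNReal.ofReal (4 * (1 + ∑ i, (k i : ℝ) ^ 4)) * ‖fcoef f k‖ₑ ^ 2 := by
          gcongr
          exact ENNReal.ofReal_le_ofReal (one_add_knsq_rpow_le hs k)
      _ = 4 * (‖fcoef f k‖ₑ ^ 2 + ∑ i, ENNReal.ofReal ((k i : ℝ) ^ 4) * ‖fcoef f k‖ₑ ^ 2) := by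
          rw [ENNReal.ofReal_mul (by norm_num), ENNReal.ofReal_add zero_le_one (by positivity),
            ENNReal.ofReal_sum_of_nonneg fun i _ => by positivity, ← Finset.sum_mul]
          simp only [ENNReal.ofReal_ofNat, ENNReal.ofReal_one]
          ring
      _ ≤ _ := by
          gcongr with i
          exact hcoef i k
  refine (ENNReal.tsum_le_tsum hterm).trans_lt ?_
  rw [ENNReal.tsum_mul_left, ENNReal.tsum_add, Summable.tsum_finsetSum fun _ _ => ENNReal.summable]
  refine ENNReal.mul_lt_top (by simp) (ENNReal.add_lt_top.2
    ⟨tsum_enorm_fcoef_sq_lt_top hf.continuous, ?_⟩)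
  exact ENNReal.sum_lt_top.2 fun i _ => tsum_enorm_fcoef_sq_lt_top (hdd i)

theorem sum_range_one_add_rpow_le (M : ℕ) :
    ∑ j ∈ Finset.range M, (1 + (j : ℝ)) ^ (-(7 / 9) : ℝ) ≤ 9 / 2 * (M : ℝ) ^ (2 / 9 : ℝ) := by
  induction M with
  | zero => simp
  | succ M ih =>
    rw [Finset.sum_range_succ]
    have hx : (0 : ℝ) < 1 + M := by positivity
    have hb : (1 + -(1 / (1 + (M : ℝ)))) ^ (2 / 9 : ℝ) ≤ 1 + 2 / 9 * -(1 / (1 + (M : ℝ))) := by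
      refine rpow_one_add_le_one_add_mul_self ?_ (by norm_num) (by norm_num)
      rw [neg_le_neg_iff, div_le_one hx]
      linarith [(Nat.cast_nonneg M : (0 : ℝ) ≤ M)]
    have hM : (M : ℝ) = (1 + M) * (1 + -(1 / (1 + (M : ℝ)))) := by
      field_simp
      ring
    have h0 : (0 : ℝ) ≤ 1 + -(1 / (1 + (M : ℝ))) := by
      by_contra! h
      nlinarith [(Nat.cast_nonneg M : (0 : ℝ) ≤ M)]
    have h1 : (M : ℝ) ^ (2 / 9 : ℝ) ≤
        (1 + (M : ℝ)) ^ (2 / 9 : ℝ) * (1 + 2 / 9 * -(1 / (1 + (M : ℝ)))) := by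
      calc (M : ℝ) ^ (2 / 9 : ℝ) = ((1 + M) * (1 + -(1 / (1 + (M : ℝ))))) ^ (2 / 9 : ℝ) := by
            rw [← hM]
        _ = (1 + (M : ℝ)) ^ (2 / 9 : ℝ) * (1 + -(1 / (1 + (M : ℝ)))) ^ (2 / 9 : ℝ) :=
            Real.mul_rpow hx.le h0
        _ ≤ _ := by gcongr
    have h2 : (1 + (M : ℝ)) ^ (-(7 / 9) : ℝ) = (1 + (M : ℝ)) ^ (2 / 9 : ℝ) * (1 / (1 + M)) := by
      rw [one_div, ← Real.rpow_neg_one, ← Real.rpow_add hx]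
      norm_num
    rw [Nat.cast_succ, add_comm (M : ℝ) 1]
    nlinarith

theorem sum_Icc_one_add_sq_rpow_le {T : ℝ} (hT : 1 ≤ T) :
    ∑ j ∈ Finset.Icc (-(⌊√T⌋₊ : ℤ)) ⌊√T⌋₊, (1 + (j : ℝ) ^ 2) ^ (-(7 / 18) : ℝ) ≤
      72 * T ^ (1 / 9 : ℝ) := by
  set N := ⌊√T⌋₊
  have heven : Function.Even fun j : ℤ => (1 + (j : ℝ) ^ 2) ^ (-(7 / 18) : ℝ) := fun j => by simp
  have hpt : ∀ j : ℕ, (1 + (j : ℝ) ^ 2) ^ (-(7 / 18) : ℝ) ≤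
      2 * (1 + (j : ℝ)) ^ (-(7 / 9) : ℝ) := by
    intro j
    have hj : (0 : ℝ) < 1 + j := by positivity
    calc (1 + (j : ℝ) ^ 2) ^ (-(7 / 18) : ℝ) ≤ ((1 + (j : ℝ)) ^ 2 / 2) ^ (-(7 / 18) : ℝ) :=
          Real.rpow_le_rpow_of_nonpos (by positivity)
            (by nlinarith [sq_nonneg ((j : ℝ) - 1)]) (by norm_num)
      _ = (1 + (j : ℝ)) ^ (-(7 / 9) : ℝ) * 2 ^ (7 / 18 : ℝ) := by
          rw [Real.div_rpow (by positivity) (by norm_num), ← Real.rpow_natCast,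
            ← Real.rpow_mul hj.le, Real.rpow_neg zero_le_two, div_inv_eq_mul]
          norm_num
      _ ≤ (1 + (j : ℝ)) ^ (-(7 / 9) : ℝ) * 2 ^ (1 : ℝ) := by
          gcongr <;> norm_num
      _ = _ := by rw [Real.rpow_one, mul_comm]
  have hN : ((N + 1 : ℕ) : ℝ) ^ (2 / 9 : ℝ) ≤ 4 * T ^ (1 / 9 : ℝ) := by
    have h1 : (N : ℝ) ≤ √T := Nat.floor_le (Real.sqrt_nonneg _)
    have h2 : 1 ≤ √T := Real.one_le_sqrt.2 hT
    have h3 : ((N + 1 : ℕ) : ℝ) ≤ 2 * √T := by push_cast; linarith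
    have h4 : ((N + 1 : ℕ) : ℝ) ^ 2 ≤ 4 * T := by
      calc ((N + 1 : ℕ) : ℝ) ^ 2 ≤ (2 * √T) ^ 2 := by gcongr
        _ = 4 * T := by rw [mul_pow, Real.sq_sqrt (by linarith)]; norm_num
    calc ((N + 1 : ℕ) : ℝ) ^ (2 / 9 : ℝ) = (((N + 1 : ℕ) : ℝ) ^ 2) ^ (1 / 9 : ℝ) := by
          rw [← Real.rpow_natCast, ← Real.rpow_mul (by positivity)]
          norm_num
      _ ≤ (4 * T) ^ (1 / 9 : ℝ) := by gcongr
      _ = 4 ^ (1 / 9 : ℝ) * T ^ (1 / 9 : ℝ) := Real.mul_rpow (by norm_num) (by linarith)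
      _ ≤ 4 ^ (1 : ℝ) * T ^ (1 / 9 : ℝ) := by gcongr <;> norm_num
      _ = _ := by rw [Real.rpow_one]
  calc ∑ j ∈ Finset.Icc (-(N : ℤ)) N, (1 + (j : ℝ) ^ 2) ^ (-(7 / 18) : ℝ)
      ≤ 2 * ∑ j ∈ Finset.range (N + 1), (1 + (j : ℝ) ^ 2) ^ (-(7 / 18) : ℝ) := by
        rw [Finset.sum_Icc_of_even_eq_range heven]
        simp
    _ ≤ 2 * ∑ j ∈ Finset.range (N + 1), 2 * (1 + (j : ℝ)) ^ (-(7 / 9) : ℝ) := by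
        gcongr with j
        exact hpt j
    _ = 4 * ∑ j ∈ Finset.range (N + 1), (1 + (j : ℝ)) ^ (-(7 / 9) : ℝ) := by
        rw [← Finset.mul_sum]; ring
    _ ≤ 4 * (9 / 2 * ((N + 1 : ℕ) : ℝ) ^ (2 / 9 : ℝ)) := by
        gcongr
        exact sum_range_one_add_rpow_le _
    _ ≤ _ := by linarith

open Classical in
theorem tsum_sobWeight_of_knsq_le (k : Fin 3 → ℤ) :
    ∑' n, (if knsq n ≤ knsq k then sobWeight (-(7 / 6)) n else 0) ≤
      72 ^ 3 * sobWeight (1 / 3) k := by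
  set T := 1 + knsq k with hT
  have hT1 : 1 ≤ T := one_le_one_add_knsq k
  set N := ⌊√T⌋₊
  let S : Finset (Fin 3 → ℤ) := Fintype.piFinset fun _ => Finset.Icc (-(N : ℤ)) N
  have hS : ∀ n, knsq n ≤ knsq k → n ∈ S := by
    intro n hn
    rw [Fintype.mem_piFinset]
    intro i
    have h1 : (n i : ℝ) ^ 2 ≤ knsq n :=
      Finset.single_le_sum (f := fun i => (n i : ℝ) ^ 2) (fun _ _ => sq_nonneg _)
        (Finset.mem_univ i)
    have h2 : |(n i : ℝ)| ≤ √T := Real.abs_le_sqrt (by linarith)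
    have h3 : (n i).natAbs ≤ N := Nat.le_floor (by rwa [Nat.cast_natAbs, Int.cast_abs])
    rw [Finset.mem_Icc]
    omega
  have hpt : ∀ n, (1 + knsq n) ^ (-(7 / 6) : ℝ) ≤
      ∏ i, (1 + (n i : ℝ) ^ 2) ^ (-(7 / 18) : ℝ) := by
    intro n
    calc (1 + knsq n) ^ (-(7 / 6) : ℝ) = ∏ _i : Fin 3, (1 + knsq n) ^ (-(7 / 18) : ℝ) := by
          rw [Finset.prod_const, ← Real.rpow_natCast, ← Real.rpow_mul (one_add_knsq_pos n).le]
          norm_num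
      _ ≤ _ := by
          refine Finset.prod_le_prod (fun i _ => Real.rpow_nonneg (one_add_knsq_pos n).le _)
            fun i _ => Real.rpow_le_rpow_of_nonpos (by positivity) ?_ (by norm_num)
          exact add_le_add_right (Finset.single_le_sum (f := fun i => (n i : ℝ) ^ 2)
            (fun _ _ => sq_nonneg _) (Finset.mem_univ i)) _
  rw [tsum_eq_sum (s := S) fun n hn => if_neg fun h => hn (hS n h)]
  calc ∑ n ∈ S, (if knsq n ≤ knsq k then sobWeight (-(7 / 6)) n else 0)
      ≤ ∑ n ∈ S, ENNReal.ofReal (∏ i, (1 + (n i : ℝ) ^ 2) ^ (-(7 / 18) : ℝ)) := by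
        refine Finset.sum_le_sum fun n _ => ?_
        split_ifs
        · exact ENNReal.ofReal_le_ofReal (hpt n)
        · exact zero_le
    _ = ENNReal.ofReal (∑ n ∈ S, ∏ i, (1 + (n i : ℝ) ^ 2) ^ (-(7 / 18) : ℝ)) :=
        (ENNReal.ofReal_sum_of_nonneg fun n _ => by positivity).symm
    _ = ENNReal.ofReal ((∑ j ∈ Finset.Icc (-(N : ℤ)) N,
          (1 + (j : ℝ) ^ 2) ^ (-(7 / 18) : ℝ)) ^ 3) := by
        rw [← Finset.prod_univ_sum (fun _ => Finset.Icc (-(N : ℤ)) N)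
          (fun _ j => (1 + (j : ℝ) ^ 2) ^ (-(7 / 18) : ℝ))]
        simp
    _ ≤ ENNReal.ofReal ((72 * T ^ (1 / 9 : ℝ)) ^ 3) := by
        refine ENNReal.ofReal_le_ofReal ?_
        gcongr
        exact sum_Icc_one_add_sq_rpow_le hT1
    _ = 72 ^ 3 * sobWeight (1 / 3) k := by
        rw [mul_pow, ← Real.rpow_natCast (T ^ _), ← Real.rpow_mul (by linarith),
          ENNReal.ofReal_mul (by norm_num), sobWeight]
        norm_num [hT]

theorem sq_tsum_le_tsum_mul_tsum {ι : Type*} {f g h : ι → ENNReal}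
    (hh : ∀ i, h i ^ 2 ≤ f i * g i) : (∑' i, h i) ^ 2 ≤ (∑' i, f i) * ∑' i, g i := by
  have hle : ∀ i, h i ≤ f i ^ (1 / 2 : ℝ) * g i ^ (1 / 2 : ℝ) := by
    intro i
    rw [← ENNReal.mul_rpow_of_nonneg _ _ (by norm_num), one_div,
      ENNReal.le_rpow_inv_iff two_pos, ENNReal.rpow_two]
    exact hh i
  have key : ∑' i, h i ≤ (∑' i, f i) ^ (1 / 2 : ℝ) * (∑' i, g i) ^ (1 / 2 : ℝ) := by
    refine ENNReal.summable.tsum_le_of_sum_le fun s => ?_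
    refine (Finset.sum_le_sum fun i _ => hle i).trans ?_
    refine (ENNReal.inner_le_Lp_mul_Lq s _ _ Real.HolderConjugate.two_two).trans ?_
    simp only [← ENNReal.rpow_mul]
    norm_num
    gcongr <;> exact ENNReal.sum_le_tsum s
  calc (∑' i, h i) ^ 2 ≤ ((∑' i, f i) ^ (1 / 2 : ℝ) * (∑' i, g i) ^ (1 / 2 : ℝ)) ^ 2 := by gcongr
    _ = _ := by
      rw [mul_pow, ← ENNReal.rpow_natCast, ← ENNReal.rpow_natCast, ← ENNReal.rpow_mul,
        ← ENNReal.rpow_mul]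
      norm_num

theorem sobWeight_mul (s t : ℝ) (k : Fin 3 → ℤ) :
    sobWeight s k * sobWeight t k = sobWeight (s + t) k := by
  rw [sobWeight, sobWeight, sobWeight,
    ← ENNReal.ofReal_mul (Real.rpow_nonneg (one_add_knsq_pos k).le _),
    Real.rpow_add (one_add_knsq_pos k)]

theorem sobWeight_zero (k : Fin 3 → ℤ) : sobWeight 0 k = 1 := by
  simp [sobWeight]

theorem sobWeight_mono {s : ℝ} (hs : 0 ≤ s) {k m : Fin 3 → ℤ} (h : knsq k ≤ knsq m) :
    sobWeight s k ≤ sobWeight s m :=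
  ENNReal.ofReal_le_ofReal <|
    Real.rpow_le_rpow (one_add_knsq_pos k).le (add_le_add_right h _) hs

theorem sobWeight_le_of_le_four_mul {s : ℝ} (hs : 0 ≤ s) (hs2 : s ≤ 2) {k m : Fin 3 → ℤ}
    (h : 1 + knsq k ≤ 4 * (1 + knsq m)) : sobWeight s k ≤ 16 * sobWeight s m := by
  have h0 := Real.rpow_nonneg (one_add_knsq_pos m).le s
  have : (1 + knsq k) ^ s ≤ 16 * (1 + knsq m) ^ s := by
    calc (1 + knsq k) ^ s ≤ (4 * (1 + knsq m)) ^ s :=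
          Real.rpow_le_rpow (one_add_knsq_pos k).le h hs
      _ = 4 ^ s * (1 + knsq m) ^ s := Real.mul_rpow (by norm_num) (one_add_knsq_pos m).le
      _ ≤ 4 ^ (2 : ℝ) * (1 + knsq m) ^ s := by gcongr; norm_num
      _ = _ := by norm_num
  calc sobWeight s k ≤ ENNReal.ofReal (16 * (1 + knsq m) ^ s) := ENNReal.ofReal_le_ofReal this
    _ = _ := by rw [ENNReal.ofReal_mul (by norm_num), ENNReal.ofReal_ofNat, sobWeight]

theorem sobWeight_neg_le_of_le_four_mul {s : ℝ} (hs : 0 ≤ s) (hs2 : s ≤ 2) {k m : Fin 3 → ℤ}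
    (h : 1 + knsq k ≤ 4 * (1 + knsq m)) : sobWeight (-s) m ≤ 16 * sobWeight (-s) k := by
  calc sobWeight (-s) m = sobWeight (-s) m * (sobWeight s k * sobWeight (-s) k) := by
        rw [sobWeight_mul, add_neg_cancel, sobWeight_zero, mul_one]
    _ ≤ sobWeight (-s) m * ((16 * sobWeight s m) * sobWeight (-s) k) := by
        gcongr
        exact sobWeight_le_of_le_four_mul hs hs2 h
    _ = 16 * (sobWeight (-s) m * sobWeight s m) * sobWeight (-s) k := by ring
    _ = _ := by rw [sobWeight_mul, neg_add_cancel, sobWeight_zero, mul_one]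

theorem tsum_tsum_sub_mul {G : Type*} [AddCommGroup G] (F H : G → ENNReal) :
    ∑' k, ∑' n, F (k - n) * H n = (∑' m, F m) * ∑' n, H n := by
  rw [ENNReal.tsum_comm, ← ENNReal.tsum_mul_left]
  refine tsum_congr fun n => ?_
  rw [ENNReal.tsum_mul_right]
  exact congrArg (· * H n) ((Equiv.subRight n).tsum_eq F)

open Classical in
/-- Contribution to the weighted convolution estimate of frequencies with `|n| ≤ |k|`. -/
theorem tsum_sobWeight_mul_sq_tsum_le_of_le (R : (Fin 3 → ℤ) → (Fin 3 → ℤ) → Prop)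
    (a b : (Fin 3 → ℤ) → ENNReal) {s t : ℝ} {c : ENNReal}
    (hR : ∀ k n, R k n → knsq n ≤ knsq k)
    (hc : ∀ k n, R k n → sobWeight (1 / 6) k * sobWeight (7 / 6) n ≤
      c * (sobWeight s (k - n) * sobWeight t n)) :
    ∑' k, sobWeight (-(1 / 6)) k * (∑' n, if R k n then a (k - n) * b n else 0) ^ 2 ≤
      72 ^ 3 * c * ((∑' m, sobWeight s m * a m ^ 2) * ∑' n, sobWeight t n * b n ^ 2) := by
  rw [← tsum_tsum_sub_mul (fun m => sobWeight s m * a m ^ 2), ← ENNReal.tsum_mul_left]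
  refine ENNReal.tsum_le_tsum fun k => ?_
  have hcs := sq_tsum_le_tsum_mul_tsum
    (f := fun n => if knsq n ≤ knsq k then sobWeight (-(7 / 6)) n else 0)
    (g := fun n => if R k n then sobWeight (7 / 6) n * (a (k - n) ^ 2 * b n ^ 2) else 0)
    (h := fun n => if R k n then a (k - n) * b n else 0) (fun n => by
      by_cases h : R k n
      · simp only [h, hR k n h, if_true]
        rw [← mul_assoc, sobWeight_mul, neg_add_cancel, sobWeight_zero, one_mul, mul_pow]
      · simp [h])
  calc sobWeight (-(1 / 6)) k * (∑' n, if R k n then a (k - n) * b n else 0) ^ 2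
      ≤ sobWeight (-(1 / 6)) k * ((72 ^ 3 * sobWeight (1 / 3) k) *
          ∑' n, if R k n then sobWeight (7 / 6) n * (a (k - n) ^ 2 * b n ^ 2) else 0) := by
        gcongr
        refine hcs.trans ?_
        gcongr
        exact tsum_sobWeight_of_knsq_le k
    _ = 72 ^ 3 * ((sobWeight (-(1 / 6)) k * sobWeight (1 / 3) k) *
          ∑' n, if R k n then sobWeight (7 / 6) n * (a (k - n) ^ 2 * b n ^ 2) else 0) := by ring
    _ = 72 ^ 3 * ∑' n, sobWeight (1 / 6) k *
          (if R k n then sobWeight (7 / 6) n * (a (k - n) ^ 2 * b n ^ 2) else 0) := by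
        rw [sobWeight_mul, ENNReal.tsum_mul_left]
        norm_num
    _ ≤ 72 ^ 3 * ∑' n, c * ((sobWeight s (k - n) * a (k - n) ^ 2) *
          (sobWeight t n * b n ^ 2)) := by
        gcongr _ * ?_
        refine ENNReal.tsum_le_tsum fun n => ?_
        split_ifs with h
        · calc sobWeight (1 / 6) k * (sobWeight (7 / 6) n * (a (k - n) ^ 2 * b n ^ 2))
              = (sobWeight (1 / 6) k * sobWeight (7 / 6) n) * (a (k - n) ^ 2 * b n ^ 2) := by ring
            _ ≤ (c * (sobWeight s (k - n) * sobWeight t n)) * (a (k - n) ^ 2 * b n ^ 2) := by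
                gcongr ?_ * _
                exact hc k n h
            _ = _ := by ring
        · simp
    _ = _ := by rw [ENNReal.tsum_mul_left, mul_assoc]

open Classical in
/-- Contribution to the weighted convolution estimate of frequencies with `|k| ≤ |n| ≲ |k - n|`. -/
theorem tsum_sobWeight_mul_sq_tsum_le_of_ge (a b : (Fin 3 → ℤ) → ENNReal) :
    ∑' k, sobWeight (-(1 / 6)) k * (∑' n, if knsq k ≤ knsq n ∧
        1 + knsq n ≤ 4 * (1 + knsq (k - n)) then a (k - n) * b n else 0) ^ 2 ≤
      72 ^ 3 * 16 * ((∑' m, sobWeight (1 / 6) m * a m ^ 2) *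
        ∑' n, sobWeight (7 / 6) n * b n ^ 2) := by
  set A := ∑' m, sobWeight (1 / 6) m * a m ^ 2
  have hcs : ∀ k, (∑' n, if knsq k ≤ knsq n ∧ 1 + knsq n ≤ 4 * (1 + knsq (k - n)) then
      a (k - n) * b n else 0) ^ 2 ≤
      A * ∑' n, if knsq k ≤ knsq n then 16 * sobWeight (-(1 / 6)) n * b n ^ 2 else 0 := by
    intro k
    rw [show A = ∑' n, sobWeight (1 / 6) (k - n) * a (k - n) ^ 2 from
      ((Equiv.subLeft k).tsum_eq fun m => sobWeight (1 / 6) m * a m ^ 2).symm]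
    refine sq_tsum_le_tsum_mul_tsum fun n => ?_
    split_ifs with h h1 h1
    · calc (a (k - n) * b n) ^ 2
          = (sobWeight (1 / 6) (k - n) * sobWeight (-(1 / 6)) (k - n)) *
              (a (k - n) ^ 2 * b n ^ 2) := by
            rw [sobWeight_mul, add_neg_cancel, sobWeight_zero, one_mul, mul_pow]
        _ ≤ (sobWeight (1 / 6) (k - n) * (16 * sobWeight (-(1 / 6)) n)) *
              (a (k - n) ^ 2 * b n ^ 2) := by
            gcongr ?_ * _
            gcongr _ * ?_
            exact sobWeight_neg_le_of_le_four_mul (by norm_num) (by norm_num) h.2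
        _ = _ := by ring
    · exact absurd h.1 h1
    · simp
    · simp
  have hk : ∀ n, ∑' k, (if knsq k ≤ knsq n then sobWeight (-(1 / 6)) k else 0) ≤
      72 ^ 3 * sobWeight (4 / 3) n := by
    intro n
    calc ∑' k, (if knsq k ≤ knsq n then sobWeight (-(1 / 6)) k else 0)
        ≤ ∑' k, sobWeight 1 n * (if knsq k ≤ knsq n then sobWeight (-(7 / 6)) k else 0) := by
          refine ENNReal.tsum_le_tsum fun k => ?_
          split_ifs with h
          · rw [show (-(1 / 6) : ℝ) = 1 + -(7 / 6) by norm_num, ← sobWeight_mul]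
            gcongr
            exact sobWeight_mono zero_le_one h
          · simp
      _ ≤ sobWeight 1 n * (72 ^ 3 * sobWeight (1 / 3) n) := by
          rw [ENNReal.tsum_mul_left]
          gcongr
          exact tsum_sobWeight_of_knsq_le n
      _ = 72 ^ 3 * (sobWeight 1 n * sobWeight (1 / 3) n) := by ring
      _ = _ := by rw [sobWeight_mul]; norm_num
  calc ∑' k, sobWeight (-(1 / 6)) k * (∑' n, if knsq k ≤ knsq n ∧
        1 + knsq n ≤ 4 * (1 + knsq (k - n)) then a (k - n) * b n else 0) ^ 2
      ≤ ∑' k, sobWeight (-(1 / 6)) k * (A *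
          ∑' n, if knsq k ≤ knsq n then 16 * sobWeight (-(1 / 6)) n * b n ^ 2 else 0) := by
        gcongr with k
        exact hcs k
    _ = A * ∑' k, ∑' n, (16 * sobWeight (-(1 / 6)) n * b n ^ 2) *
          (if knsq k ≤ knsq n then sobWeight (-(1 / 6)) k else 0) := by
        rw [← ENNReal.tsum_mul_left]
        refine tsum_congr fun k => ?_
        rw [mul_left_comm, ← ENNReal.tsum_mul_left]
        congr 2
        ext n
        split_ifs <;> ring
    _ ≤ A * ∑' n, (16 * sobWeight (-(1 / 6)) n * b n ^ 2) * (72 ^ 3 * sobWeight (4 / 3) n) := by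
        rw [ENNReal.tsum_comm]
        simp only [ENNReal.tsum_mul_left]
        gcongr with n
        exact hk n
    _ = A * ∑' n, (72 ^ 3 * 16) * (sobWeight (7 / 6) n * b n ^ 2) := by
        congr 2
        ext n
        rw [show (7 / 6 : ℝ) = -(1 / 6) + 4 / 3 by norm_num, ← sobWeight_mul]
        ring
    _ = _ := by rw [ENNReal.tsum_mul_left]; ring

theorem sq_add_add_le (x y z : ENNReal) : (x + y + z) ^ 2 ≤ 3 * (x ^ 2 + y ^ 2 + z ^ 2) := by
  have h := sq_tsum_le_tsum_mul_tsum (f := fun _ : Fin 3 => 1) (g := fun i => ![x, y, z] i ^ 2)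
    (h := ![x, y, z]) (by simp)
  simpa [tsum_fintype, Fin.sum_univ_three] using h

open Classical in
theorem tsum_sobWeight_mul_sq_convolution_le (a b : (Fin 3 → ℤ) → ENNReal) :
    ∑' k, sobWeight (-(1 / 6)) k * (∑' n, a (k - n) * b n) ^ 2 ≤
      9 * 72 ^ 3 * 16 * ((∑' m, sobWeight (1 / 6) m * a m ^ 2) *
        ∑' n, sobWeight (7 / 6) n * b n ^ 2) := by
  obtain ⟨R₁, hR₁⟩ : ∃ R : (Fin 3 → ℤ) → (Fin 3 → ℤ) → Prop, ∀ k n,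
      R k n ↔ knsq n ≤ knsq k ∧ 1 + knsq k ≤ 4 * (1 + knsq (k - n)) := ⟨_, fun _ _ => Iff.rfl⟩
  have h₁ := tsum_sobWeight_mul_sq_tsum_le_of_le R₁ a b (s := 1 / 6) (t := 7 / 6) (c := 16)
    (fun k n h => ((hR₁ k n).1 h).1) (fun k n h => by
      rw [← mul_assoc]
      gcongr
      exact sobWeight_le_of_le_four_mul (by norm_num) (by norm_num) ((hR₁ k n).1 h).2)
  have h₂ := tsum_sobWeight_mul_sq_tsum_le_of_le R₁ b a (s := 7 / 6) (t := 1 / 6) (c := 16)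
    (fun k n h => ((hR₁ k n).1 h).1) (fun k n h => by
      calc sobWeight (1 / 6) k * sobWeight (7 / 6) n
          = sobWeight (1 / 6) k * sobWeight 1 n * sobWeight (1 / 6) n := by
            rw [mul_assoc, sobWeight_mul]; norm_num
        _ ≤ sobWeight (1 / 6) k * sobWeight 1 k * sobWeight (1 / 6) n := by
            gcongr
            exact sobWeight_mono zero_le_one ((hR₁ k n).1 h).1
        _ = sobWeight (7 / 6) k * sobWeight (1 / 6) n := by
            rw [sobWeight_mul]; norm_num
        _ ≤ 16 * sobWeight (7 / 6) (k - n) * sobWeight (1 / 6) n := by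
            gcongr
            exact sobWeight_le_of_le_four_mul (by norm_num) (by norm_num) ((hR₁ k n).1 h).2
        _ = _ := mul_assoc _ _ _)
  have h₃ := tsum_sobWeight_mul_sq_tsum_le_of_ge a b
  have hsplit : ∀ k, ∑' n, a (k - n) * b n ≤
      (∑' n, if R₁ k n then a (k - n) * b n else 0) +
      (∑' n, if R₁ k n then b (k - n) * a n else 0) +
      ∑' n, if knsq k ≤ knsq n ∧ 1 + knsq n ≤ 4 * (1 + knsq (k - n)) then
        a (k - n) * b n else 0 := by
    intro k
    rw [← (Equiv.subLeft k).tsum_eq fun n => if R₁ k n then b (k - n) * a n else 0,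
      ← ENNReal.tsum_add, ← ENNReal.tsum_add]
    refine ENNReal.tsum_le_tsum fun n => ?_
    simp only [Equiv.subLeft_apply, sub_sub_cancel]
    have hk : 1 + knsq k ≤ 2 * (1 + knsq (k - n)) + 2 * (1 + knsq n) := by
      simpa using one_add_knsq_add_le (k - n) n
    have hn : 1 + knsq n ≤ 2 * (1 + knsq k) + 2 * (1 + knsq (k - n)) := by
      have := one_add_knsq_add_le k (n - k)
      rwa [add_sub_cancel, ← neg_sub k n, knsq_neg] at this
    have hcases : R₁ k n ∨ R₁ k (k - n) ∨
        (knsq k ≤ knsq n ∧ 1 + knsq n ≤ 4 * (1 + knsq (k - n))) := by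
      simp only [hR₁, sub_sub_cancel]
      rcases le_total (knsq n) (knsq (k - n)) with h | h
      · rcases le_total (knsq n) (knsq k) with h' | h'
        · exact Or.inl ⟨h', by linarith⟩
        · exact Or.inr (Or.inr ⟨h', by linarith [one_le_one_add_knsq n]⟩)
      · rcases le_total (knsq (k - n)) (knsq k) with h' | h'
        · exact Or.inr (Or.inl ⟨h', by linarith⟩)
        · exact Or.inr (Or.inr ⟨h'.trans h, by linarith⟩)
    rcases hcases with h | h | h
    · rw [if_pos h, add_assoc]
      exact le_self_add
    · rw [if_pos h, mul_comm (b n)]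
      exact le_add_self.trans le_self_add
    · rw [if_pos h]
      exact le_add_self
  calc ∑' k, sobWeight (-(1 / 6)) k * (∑' n, a (k - n) * b n) ^ 2
      ≤ ∑' k, 3 * (sobWeight (-(1 / 6)) k * (∑' n, if R₁ k n then a (k - n) * b n else 0) ^ 2 +
          sobWeight (-(1 / 6)) k * (∑' n, if R₁ k n then b (k - n) * a n else 0) ^ 2 +
          sobWeight (-(1 / 6)) k * (∑' n, if knsq k ≤ knsq n ∧
            1 + knsq n ≤ 4 * (1 + knsq (k - n)) then a (k - n) * b n else 0) ^ 2) := by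
        refine ENNReal.tsum_le_tsum fun k => ?_
        rw [← mul_add, ← mul_add, mul_left_comm]
        gcongr
        exact (pow_le_pow_left' (hsplit k) 2).trans (sq_add_add_le _ _ _)
    _ ≤ 3 * (72 ^ 3 * 16 * ((∑' m, sobWeight (1 / 6) m * a m ^ 2) *
          ∑' n, sobWeight (7 / 6) n * b n ^ 2) +
        72 ^ 3 * 16 * ((∑' m, sobWeight (7 / 6) m * b m ^ 2) *
          ∑' n, sobWeight (1 / 6) n * a n ^ 2) +
        72 ^ 3 * 16 * ((∑' m, sobWeight (1 / 6) m * a m ^ 2) *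
          ∑' n, sobWeight (7 / 6) n * b n ^ 2)) := by
        rw [ENNReal.tsum_mul_left, ENNReal.tsum_add, ENNReal.tsum_add]
        gcongr
    _ = _ := by ring

theorem sobSq_mul_le {f g : (Fin 3 → ℝ) → ℂ} (hf : ContDiff ℝ 2 f) (hg : ContDiff ℝ 2 g)
    (hfp : ∀ x i, f (x + Pi.single i 1) = f x) (hgp : ∀ x i, g (x + Pi.single i 1) = g x) :
    sobSq (-(1 / 6)) (fun x => f x * g x) ≤
      (9 * 72 ^ 3 * 16) * (sobSq (1 / 6) f * sobSq (7 / 6) g) := by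
  have h : ∑' k, sobWeight (-(1 / 6)) k * ‖fcoef (fun x => f x * g x) k‖ₑ ^ 2 ≤
      9 * 72 ^ 3 * 16 * ((∑' m, sobWeight (1 / 6) m * ‖fcoef f m‖ₑ ^ 2) *
        ∑' n, sobWeight (7 / 6) n * ‖fcoef g n‖ₑ ^ 2) := by
    refine le_trans ?_ (tsum_sobWeight_mul_sq_convolution_le _ _)
    gcongr with k
    exact enorm_fcoef_mul_le hf.continuous hg.continuous k
  have hF := tsum_sobWeight_mul_enorm_fcoef_sq_lt_top hf hfp (s := 1 / 6) (by norm_num)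
  have hG := tsum_sobWeight_mul_enorm_fcoef_sq_lt_top hg hgp (s := 7 / 6) (by norm_num)
  simp only [sobSq_eq_toReal]
  refine (ENNReal.toReal_mono (ENNReal.mul_ne_top (by norm_num)
    (ENNReal.mul_ne_top hF.ne hG.ne)) h).trans_eq ?_
  simp [ENNReal.toReal_mul]

/-- critical bilinear estimate: for smooth zero-mean periodic vector
fields `v, w` on `𝕋³`,
`‖v ⊗ w‖_{W^{−1/6,2}} ≤ C ‖v‖_{W^{1/6,2}} ‖w‖_{W^{1+1/6,2}}`. -/
theorem stmt14 :
    ∃ C : ℝ, 0 < C ∧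
      ∀ v w : (Fin 3 → ℝ) → (Fin 3 → ℝ),
        ContDiff ℝ (⊤ : ℕ∞) v → ContDiff ℝ (⊤ : ℕ∞) w →
        (∀ (x : Fin 3 → ℝ) (i : Fin 3), v (x + Pi.single i 1) = v x) →
        (∀ (x : Fin 3 → ℝ) (i : Fin 3), w (x + Pi.single i 1) = w x) →
        (∫ x in Set.Icc (0 : Fin 3 → ℝ) 1, v x) = 0 →
        (∫ x in Set.Icc (0 : Fin 3 → ℝ) 1, w x) = 0 →
        Real.sqrt (∑ i, ∑ j,
            sobSq (-(1 / 6)) (fun x => ((v x i * w x j : ℝ) : ℂ)))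
          ≤ C * Real.sqrt (∑ i, sobSq (1 / 6) (fun x => ((v x i : ℝ) : ℂ)))
              * Real.sqrt (∑ i, sobSq (1 + 1 / 6) (fun x => ((w x i : ℝ) : ℂ))) := by
  refine ⟨√(9 * 72 ^ 3 * 16), by positivity, fun v w hv hw hvp hwp _ _ => ?_⟩
  have hsmooth : ∀ {u : (Fin 3 → ℝ) → (Fin 3 → ℝ)}, ContDiff ℝ (⊤ : ℕ∞) u → ∀ i,
      ContDiff ℝ 2 fun x => ((u x i : ℝ) : ℂ) := fun hu i =>
    Complex.ofRealCLM.contDiff.comp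
      ((contDiff_pi.1 hu i).of_le (WithTop.coe_le_coe.2 le_top))
  have hnonneg : ∀ s f, 0 ≤ sobSq s f := fun s f => by
    rw [sobSq_eq_toReal]
    exact ENNReal.toReal_nonneg
  rw [← Real.sqrt_mul (by norm_num), ← Real.sqrt_mul (mul_nonneg (by norm_num)
    (Finset.sum_nonneg fun i _ => hnonneg _ _))]
  refine Real.sqrt_le_sqrt ?_
  rw [mul_assoc, Finset.sum_mul_sum, Finset.mul_sum]
  refine Finset.sum_le_sum fun i _ => ?_
  rw [Finset.mul_sum]
  refine Finset.sum_le_sum fun j _ => ?_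
  have h := sobSq_mul_le (hsmooth hv i) (hsmooth hw j) (fun x l => by rw [hvp])
    (fun x l => by rw [hwp])
  simp only [← Complex.ofReal_mul] at h
  rwa [show (1 + 1 / 6 : ℝ) = 7 / 6 by norm_num]
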